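/- arXiv:1105.1239 — 3 statements merged into one kernel-verified Lean document; each statement's English description precedes it below -/
import Mathlib

section
/- Suppose k satisfies assumption (*), and let 0 < γ ≤ 1. Then there exists a completely monotone function g_γ : (0,∞) → [0,∞) such that ∫₀^∞ e^{−ps} g_γ(s) ds = (p·K(p))^{−γ/2} for all p > 0; in other words, the Stieltjes representation of p ↦ (pK(p))^{−γ/2} has vanishing constant terms c and d. Consequently, ∫₀ᵗ g_γ(τ) dτ → 0 as t → 0+. -/
open MeasureTheory Filter Set

/-- A function `g` is completely monotone on `(0, ∞)` if it is infinitely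
differentiable there and `(-1)^n * g^(n)(t) ≥ 0` for all `t > 0`, `n ≥ 0`. -/
def CompletelyMonotone (g : ℝ → ℝ) : Prop :=
  ContDiffOn ℝ (⊤ : ℕ∞) g (Set.Ioi 0) ∧
  ∀ (n : ℕ) (t : ℝ), 0 < t → 0 ≤ (-1 : ℝ) ^ n * iteratedDeriv n g t
open scoped Topology

section Stieltjes

open scoped unitInterval

/-- Functions of the form `p ↦ ∫ (1 - x + p x)⁻¹ dν(x)` with `ν` a finite measure on `[0, 1]`; the
substitution `x = (1 + t)⁻¹` identifies them with the Stieltjes functions. -/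
def IsStieltjes (h : ℝ → ℝ) : Prop :=
  ∃ ν : FiniteMeasure I, ∀ p, 0 < p → h p = ∫ x : I, (1 - (x : ℝ) + p * x)⁻¹ ∂(ν : Measure I)

lemma stieltjes_kernel_pos {p x : ℝ} (hp : 0 < p) (hx : x ∈ Icc (0 : ℝ) 1) :
    0 < 1 - x + p * x := by
  obtain ⟨h0, h1⟩ := hx
  rcases h0.eq_or_lt with rfl | h0
  · simp
  · have := mul_pos hp h0
    linarith

lemma continuous_stieltjes_kernel {p : ℝ} (hp : 0 < p) :
    Continuous fun x : I => (1 - (x : ℝ) + p * x)⁻¹ :=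
  Continuous.inv₀ (by fun_prop) fun x => (stieltjes_kernel_pos hp x.2).ne'

lemma integrable_of_continuous_unitInterval {f : I → ℝ} (hf : Continuous f)
    (ν : FiniteMeasure I) : Integrable f (ν : Measure I) :=
  (BoundedContinuousFunction.mkOfCompact ⟨f, hf⟩).integrable _

namespace IsStieltjes

lemma congr {f h : ℝ → ℝ} (hf : IsStieltjes f) (hfh : ∀ p, 0 < p → h p = f p) :
    IsStieltjes h := by
  obtain ⟨ν, hν⟩ := hf
  exact ⟨ν, fun p hp => (hfh p hp).trans (hν p hp)⟩

lemma zero : IsStieltjes fun _ => 0 := ⟨0, fun p _ => by simp⟩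

lemma add {f h : ℝ → ℝ} (hf : IsStieltjes f) (hh : IsStieltjes h) :
    IsStieltjes fun p => f p + h p := by
  obtain ⟨ν, hν⟩ := hf
  obtain ⟨μ, hμ⟩ := hh
  refine ⟨ν + μ, fun p hp => ?_⟩
  beta_reduce
  rw [hν p hp, hμ p hp, FiniteMeasure.toMeasure_add, integral_add_measure]
  all_goals exact integrable_of_continuous_unitInterval (continuous_stieltjes_kernel hp) _

lemma const_mul {f : ℝ → ℝ} (hf : IsStieltjes f) {c : ℝ} (hc : 0 ≤ c) :
    IsStieltjes fun p => c * f p := by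
  obtain ⟨ν, hν⟩ := hf
  lift c to NNReal using hc
  refine ⟨c • ν, fun p hp => ?_⟩
  beta_reduce
  rw [hν p hp, FiniteMeasure.toMeasure_smul, integral_smul_nnreal_measure]
  rfl

lemma sum {ι : Type*} (s : Finset ι) {f : ι → ℝ → ℝ} (hf : ∀ i ∈ s, IsStieltjes (f i)) :
    IsStieltjes fun p => ∑ i ∈ s, f i p := by
  classical
  induction s using Finset.induction_on with
  | empty => simpa using zero
  | insert i s hi ih =>
    simp only [Finset.sum_insert hi]
    exact (hf i (by simp)).add (ih fun j hj => hf j (by simp [hj]))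

lemma kernel {x : ℝ} (hx : x ∈ Icc (0 : ℝ) 1) : IsStieltjes fun p => (1 - x + p * x)⁻¹ :=
  ⟨⟨Measure.dirac ⟨x, hx⟩, inferInstance⟩, fun p _ => by simp⟩

lemma const {c : ℝ} (hc : 0 ≤ c) : IsStieltjes fun _ => c := by
  simpa using (kernel (x := 0) (by simp)).const_mul hc

lemma inv_add_const {t : ℝ} (ht : 0 ≤ t) : IsStieltjes fun p => (p + t)⁻¹ := by
  have h1 : 0 < 1 + t := by linarith
  refine ((kernel (x := (1 + t)⁻¹) ⟨by positivity, inv_le_one_of_one_le₀ (by linarith)⟩).const_mul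
    (inv_nonneg.2 h1.le)).congr fun p hp => ?_
  rw [← mul_inv]
  congr 1
  field_simp
  ring

lemma of_tendsto {f : ℕ → ℝ → ℝ} {h : ℝ → ℝ} (hf : ∀ n, IsStieltjes (f n))
    (hlim : ∀ p, 0 < p → Tendsto (fun n => f n p) atTop (𝓝 (h p))) : IsStieltjes h := by
  choose ν hν using hf
  have hmass (n : ℕ) : ((ν n).mass : ℝ) = f n 1 := by
    rw [hν n 1 one_pos]
    simp only [one_mul, sub_add_cancel, inv_one, integral_const, smul_eq_mul, mul_one]
    rfl
  have hbdd : ∃ C : NNReal, ∀ n, (ν n).mass ≤ C := by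
    obtain ⟨C, hC⟩ := (hlim 1 one_pos).bddAbove_range
    refine ⟨C.toNNReal, fun n => ?_⟩
    rw [← NNReal.coe_le_coe, hmass]
    exact (hC ⟨n, rfl⟩).trans (Real.le_coe_toNNReal C)
  obtain ⟨C, hC⟩ := hbdd
  obtain ⟨μ, -, hμ⟩ := isCompact_iff_ultrafilter_le_nhds.1
    (isCompact_setOfPred_finiteMeasure_le_of_compactSpace I C)
    ((hyperfilter ℕ : Ultrafilter ℕ).map ν) (le_principal_iff.2
      (Ultrafilter.mem_map.2 (univ_mem' hC)))
  have hμ' : Tendsto ν (hyperfilter ℕ : Filter ℕ) (𝓝 μ) := hμ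
  refine ⟨μ, fun p hp => ?_⟩
  have h1 := FiniteMeasure.tendsto_iff_forall_integral_tendsto.1 hμ'
    (BoundedContinuousFunction.mkOfCompact ⟨_, continuous_stieltjes_kernel hp⟩)
  have h2 := (hlim p hp).mono_left Nat.hyperfilter_le_atTop
  refine tendsto_nhds_unique h2 ?_
  simpa [hν _ p hp] using h1

end IsStieltjes

/-- Discretisation of a finite measure on `[0, 1]`, with atoms in the open interval. -/
lemma exists_discretisation (ν : FiniteMeasure I) :
    ∃ w : ℕ → ℕ → ℝ, (∀ n i, 0 ≤ w n i) ∧ ∀ φ : ℝ → ℝ, ContinuousOn φ (Icc 0 1) →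
      Tendsto (fun n : ℕ => ∑ i ∈ Finset.range (n + 1), w n i * φ ((i + 1) / (n + 2))) atTop
        (𝓝 (∫ x : I, φ x ∂(ν : Measure I))) := by
  let S (n i : ℕ) : Set I := {x | ⌊n * (x : ℝ)⌋₊ = i}
  have hS (n i : ℕ) : MeasurableSet (S n i) :=
    measurableSet_eq_fun (by fun_prop) measurable_const
  let d (n : ℕ) (x : I) : ℝ := (⌊n * (x : ℝ)⌋₊ + 1) / (n + 2)
  have hfl (n : ℕ) (x : I) : ⌊n * (x : ℝ)⌋₊ ≤ n :=
    Nat.floor_le_of_le (mul_le_of_le_one_right (by positivity) x.2.2)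
  have hd (n : ℕ) (x : I) : d n x ∈ Icc (0 : ℝ) 1 := by
    have : (⌊n * (x : ℝ)⌋₊ : ℝ) ≤ n := by exact_mod_cast hfl n x
    exact ⟨by positivity, by rw [div_le_one (by positivity)]; linarith⟩
  refine ⟨fun n i => (ν : Measure I).real (S n i), fun n i => measureReal_nonneg, fun φ hφ => ?_⟩
  have hsum (n : ℕ) (x : I) : φ (d n x) = ∑ i ∈ Finset.range (n + 1),
      (S n i).indicator (fun _ => φ ((i + 1) / (n + 2))) x := by
    rw [Finset.sum_eq_single_of_mem ⌊n * (x : ℝ)⌋₊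
      (Finset.mem_range.2 (Nat.lt_succ_of_le (hfl n x)))]
    · exact (indicator_of_mem (show x ∈ S n _ from rfl) fun _ => φ (d n x)).symm
    · intro i _ hi
      exact indicator_of_notMem (fun h : x ∈ S n i => hi (Eq.symm h)) _
  have heq (n : ℕ) : ∫ x : I, φ (d n x) ∂(ν : Measure I) = ∑ i ∈ Finset.range (n + 1),
      (ν : Measure I).real (S n i) * φ ((i + 1) / (n + 2)) := by
    simp_rw [hsum n]
    rw [integral_finsetSum _ fun i _ => (integrable_const _).indicator (hS n i)]
    refine Finset.sum_congr rfl fun i _ => ?_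
    rw [integral_indicator_const _ (hS n i), smul_eq_mul]
  have hlim (x : I) : Tendsto (fun n => d n x) atTop (𝓝 (x : ℝ)) := by
    have h0 : Tendsto (fun n : ℕ => 2 * (1 / ((n : ℝ) + 1))) atTop (𝓝 0) := by
      simpa only [mul_zero] using tendsto_one_div_add_atTop_nhds_zero_nat.const_mul (2 : ℝ)
    rw [tendsto_iff_norm_sub_tendsto_zero]
    refine squeeze_zero (fun n => norm_nonneg _) (fun n => ?_) h0
    have hn : (0 : ℝ) ≤ n := n.cast_nonneg
    have hx := x.2
    have h1 := Nat.floor_le (mul_nonneg hn hx.1)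
    have h2 := Nat.lt_floor_add_one (n * (x : ℝ))
    calc ‖d n x - x‖ ≤ 2 / (n + 2) := by
          rw [Real.norm_eq_abs, abs_sub_le_iff, sub_le_iff_le_add, sub_le_iff_le_add]
          constructor
          · rw [div_le_iff₀ (by positivity), add_mul, div_mul_cancel₀ _ (by positivity)]
            linarith [hx.1]
          · rw [← add_div, le_div_iff₀ (by positivity)]
            linarith [hx.2]
      _ ≤ 2 * (1 / (n + 1)) := by
          rw [mul_one_div]
          gcongr
          norm_num
  simp_rw [← heq]
  obtain ⟨C, hC⟩ := isCompact_Icc.exists_bound_of_continuousOn hφ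
  refine tendsto_integral_of_dominated_convergence (fun _ => C) (fun n => ?_) (integrable_const _)
    (fun n => .of_forall fun x => hC _ (hd n x)) (.of_forall fun x => ?_)
  · simp_rw [hsum n]
    exact (Finset.measurable_sum _ fun i _ =>
      measurable_const.indicator (hS n i)).aestronglyMeasurable
  · exact (hφ x x.2).tendsto.comp
      (tendsto_nhdsWithin_iff.2 ⟨hlim x, .of_forall fun n => hd n x⟩)

namespace IsStieltjes

/-- Resolvent matrix elements of a positive symmetric operator are Stieltjes functions. -/
lemma inner_resolvent {E : Type*} [NormedAddCommGroup E] [InnerProductSpace ℝ E]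
    [FiniteDimensional ℝ E] {A : E →ₗ[ℝ] E} (hA : A.IsSymmetric) (hpos : ∀ x, 0 ≤ inner ℝ (A x) x)
    {u : E} {w : ℝ → E} (hw : ∀ p, 0 < p → p • w p + A (w p) = u) :
    IsStieltjes fun p => inner ℝ u (w p) := by
  let b := hA.eigenvectorBasis rfl
  let l := hA.eigenvalues rfl
  have hb (i) : A (b i) = l i • b i := hA.apply_eigenvectorBasis rfl i
  have hl (i) : 0 ≤ l i := by
    have := hpos (b i)
    rwa [hb, real_inner_smul_left, real_inner_self_eq_norm_sq, b.norm_eq_one, one_pow,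
      mul_one] at this
  refine (sum Finset.univ fun i _ => (inv_add_const (hl i)).const_mul
    (sq_nonneg (inner ℝ u (b i)))).congr fun p hp => ?_
  rw [← b.sum_inner_mul_inner]
  refine Finset.sum_congr rfl fun i _ => ?_
  have h : inner ℝ u (b i) = (p + l i) * inner ℝ (b i) (w p) := by
    conv_lhs => rw [← hw p hp]
    rw [inner_add_left, real_inner_smul_left, hA, hb, real_inner_smul_right,
      real_inner_comm (w p)]
    ring
  have : p + l i ≠ 0 := by linarith [hl i]
  rw [h]
  field_simp

lemma inv_add_sum {ι : Type*} [Fintype ι] {a t : ι → ℝ} (ha : ∀ i, 0 ≤ a i) (ht : ∀ i, 0 ≤ t i)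
    {s : ℝ} (hs : 0 < s) : IsStieltjes fun p => (s + ∑ i, a i * (p / (p + t i)))⁻¹ := by
  let c := s + ∑ i, a i
  have hac : ∑ i, a i ≤ c := by simp only [c]; linarith
  have hc : 0 < c := by
    have := Finset.sum_nonneg fun i (_ : i ∈ Finset.univ) => ha i
    simp only [c]; linarith
  let u : EuclideanSpace ℝ ι := WithLp.toLp 2 fun i => √(a i * t i)
  let A : EuclideanSpace ℝ ι →ₗ[ℝ] EuclideanSpace ℝ ι :=
    { toFun := fun x => WithLp.toLp 2 (fun i => t i * x i) - (inner ℝ u x / c) • u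
      map_add' := fun x y => by
        ext i
        simp [inner_add_right]
        ring
      map_smul' := fun r x => by
        ext i
        simp [inner_smul_right]
        ring }
  have hAx (x y) : inner ℝ (A x) y = ∑ i, t i * x i * y i - inner ℝ u x * inner ℝ u y / c := by
    simp only [A, LinearMap.coe_mk, AddHom.coe_mk, inner_sub_left, real_inner_smul_left]
    congr 1
    · simp [PiLp.inner_apply, mul_comm]
    · ring
  have hsymm : A.IsSymmetric := fun x y => by
    rw [hAx, ← real_inner_comm x, hAx, mul_comm (inner ℝ u x)]
    congr 1
    exact Finset.sum_congr rfl fun i _ => by ring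
  have hpos (x) : 0 ≤ inner ℝ (A x) x := by
    rw [hAx, sub_nonneg, div_le_iff₀ hc]
    have hcs : (∑ i, √(a i * t i) * x i) ^ 2 ≤ (∑ i, a i) * ∑ i, t i * x i * x i := by
      refine Finset.sum_sq_le_sum_mul_sum_of_sq_le_mul _ (fun i _ => ha i) (fun i _ => ?_)
        fun i _ => ?_
      · rw [mul_assoc]
        exact mul_nonneg (ht i) (mul_self_nonneg _)
      · rw [mul_pow, Real.sq_sqrt (mul_nonneg (ha i) (ht i))]
        exact le_of_eq (by ring)
    have hu : inner ℝ u x = ∑ i, √(a i * t i) * x i := by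
      simp [u, PiLp.inner_apply, mul_comm]
    rw [hu, ← sq, mul_comm _ c]
    refine hcs.trans (mul_le_mul_of_nonneg_right hac (Finset.sum_nonneg fun i _ => ?_))
    rw [mul_assoc]
    exact mul_nonneg (ht i) (mul_self_nonneg _)
  let R (p : ℝ) := ∑ i, a i * t i / (p + t i)
  have hR (p : ℝ) (hp : 0 < p) : s + ∑ i, a i * (p / (p + t i)) = c - R p := by
    simp only [c, R]
    rw [add_sub_assoc, ← Finset.sum_sub_distrib]
    congr 1
    refine Finset.sum_congr rfl fun i _ => ?_
    have : p + t i ≠ 0 := by linarith [ht i]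
    field_simp
    ring
  have hRpos (p : ℝ) (hp : 0 < p) : 0 < c - R p := by
    rw [← hR p hp]
    refine add_pos_of_pos_of_nonneg hs (Finset.sum_nonneg fun i _ => ?_)
    have := ha i
    have := ht i
    positivity
  let w (p : ℝ) : EuclideanSpace ℝ ι :=
    WithLp.toLp 2 fun i => c / (c - R p) * (√(a i * t i) / (p + t i))
  have huw (p : ℝ) (hp : 0 < p) : inner ℝ u (w p) = c / (c - R p) * R p := by
    simp only [PiLp.inner_apply, u, w, R, Finset.mul_sum]
    refine Finset.sum_congr rfl fun i _ => ?_
    have h := Real.mul_self_sqrt (mul_nonneg (ha i) (ht i))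
    simp only [RCLike.inner_apply, conj_trivial]
    rw [← h, Real.sqrt_mul_self (Real.sqrt_nonneg _)]
    ring
  have hw (p : ℝ) (hp : 0 < p) : p • w p + A (w p) = u := by
    ext i
    have h1 : p + t i ≠ 0 := by linarith [ht i]
    have h2 := (hRpos p hp).ne'
    simp only [A, LinearMap.coe_mk, AddHom.coe_mk, huw p hp]
    simp only [w, u, PiLp.add_apply, PiLp.smul_apply, PiLp.sub_apply, smul_eq_mul]
    field_simp
    ring
  refine ((const (inv_nonneg.2 hc.le)).add ((inner_resolvent hsymm hpos hw).const_mul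
    (inv_nonneg.2 (sq_nonneg c)))).congr fun p hp => ?_
  have h2 := (hRpos p hp).ne'
  rw [hR p hp, huw p hp]
  field_simp
  ring

/-- If `k` is a Stieltjes function, then so is `p ↦ (s + p k(p))⁻¹`. -/
lemma inv_add_mul {k : ℝ → ℝ} (hk : IsStieltjes k) {s : ℝ} (hs : 0 < s) :
    IsStieltjes fun p => (s + p * k p)⁻¹ := by
  obtain ⟨ν, hν⟩ := hk
  obtain ⟨w, hw, hlim⟩ := exists_discretisation ν
  let y (n i : ℕ) : ℝ := (i + 1) / (n + 2)
  refine of_tendsto (f := fun n p => (s + p * ∑ i ∈ Finset.range (n + 1),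
    w n i * (1 - y n i + p * y n i)⁻¹)⁻¹) (fun n => ?_) fun p hp => ?_
  · have hy (i : Fin (n + 1)) : 0 < y n i ∧ y n i ≤ 1 := by
      have : ((i : ℕ) : ℝ) ≤ n := by exact_mod_cast Nat.le_of_lt_succ i.2
      exact ⟨by positivity, by simp only [y]; rw [div_le_one (by positivity)]; linarith⟩
    refine (inv_add_sum (ι := Fin (n + 1)) (a := fun i => w n i / y n i)
      (t := fun i => (1 - y n i) / y n i) (fun i => div_nonneg (hw n i) (hy i).1.le)
      (fun i => div_nonneg (sub_nonneg.2 (hy i).2) (hy i).1.le) hs).congr fun p hp => ?_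
    rw [Finset.sum_range, Finset.mul_sum]
    congr 2
    refine Finset.sum_congr rfl fun i _ => ?_
    have h1 := (hy i).1
    have h2 := stieltjes_kernel_pos hp ⟨h1.le, (hy i).2⟩
    have h3 : p + (1 - y n i) / y n i = (1 - y n i + p * y n i) / y n i := by
      field_simp
      ring
    rw [h3]
    field_simp
  · rw [hν p hp]
    have h0 : 0 ≤ ∫ x : I, (1 - (x : ℝ) + p * x)⁻¹ ∂(ν : Measure I) :=
      integral_nonneg fun x => (inv_pos.2 (stieltjes_kernel_pos hp x.2)).le
    refine ((((hlim (fun x => (1 - x + p * x)⁻¹) ?_).const_mul p).const_add s).inv₀ ?_)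
    · exact ContinuousOn.inv₀ (by fun_prop) fun x hx => (stieltjes_kernel_pos hp hx).ne'
    · have := mul_nonneg hp.le h0
      linarith

/-- If `k` is a positive Stieltjes function and `h` is Stieltjes, then so is `p ↦ h (p k(p))`. -/
lemma comp_mul {h k : ℝ → ℝ} (hh : IsStieltjes h) (hk : IsStieltjes k)
    (hpos : ∀ p, 0 < p → 0 < k p) : IsStieltjes fun p => h (p * k p) := by
  obtain ⟨ν, hν⟩ := hh
  obtain ⟨w, hw, hlim⟩ := exists_discretisation ν
  let y (n i : ℕ) : ℝ := (i + 1) / (n + 2)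
  refine of_tendsto (f := fun n p => ∑ i ∈ Finset.range (n + 1),
    w n i * (1 - y n i + (p * k p) * y n i)⁻¹) (fun n => sum _ fun i hi => ?_) fun p hp => ?_
  · refine const_mul ?_ (hw n i)
    have : (i : ℝ) ≤ n := by exact_mod_cast Nat.le_of_lt_succ (Finset.mem_range.1 hi)
    have h1 : 0 < y n i := by positivity
    have h2 : y n i < 1 := by simp only [y]; rw [div_lt_one (by positivity)]; linarith
    refine ((hk.inv_add_mul (s := (1 - y n i) / y n i)
      (div_pos (sub_pos.2 h2) h1)).const_mul (inv_nonneg.2 h1.le)).congr fun p hp => ?_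
    rw [← mul_inv]
    congr 1
    field_simp
  · have hG := mul_pos hp (hpos p hp)
    rw [hν _ hG]
    exact hlim (fun x => (1 - x + p * k p * x)⁻¹)
      (ContinuousOn.inv₀ (by fun_prop) fun x hx => (stieltjes_kernel_pos hG hx).ne')

end IsStieltjes

namespace IsStieltjes

lemma of_integral {τ : Measure ℝ} {s : Set ℝ} (hs : MeasurableSet s) (hs0 : s ⊆ Ici 0)
    {ρ : ℝ → ℝ} (hρ : Measurable ρ) (hρ0 : ∀ t ∈ s, 0 ≤ ρ t)
    (hint : IntegrableOn (fun t => ρ t * (1 + t)⁻¹) s τ) :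
    IsStieltjes fun p => ∫ t in s, ρ t * (p + t)⁻¹ ∂τ := by
  let m : Measure ℝ := (τ.restrict s).withDensity fun t => ENNReal.ofReal (ρ t * (1 + t)⁻¹)
  have hm : IsFiniteMeasure m := isFiniteMeasure_withDensity_ofReal hint.2
  let φ : ℝ → I := fun t => projIcc 0 1 zero_le_one (1 + t)⁻¹
  have hφ : Measurable φ := continuous_projIcc.measurable.comp (by fun_prop)
  refine ⟨⟨m.map φ, inferInstance⟩, fun p hp => ?_⟩
  have hκ := (continuous_stieltjes_kernel hp).measurable
  rw [FiniteMeasure.toMeasure_mk, integral_map hφ.aemeasurable hκ.aestronglyMeasurable,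
    integral_withDensity_eq_integral_toReal_smul (by fun_prop) (by simp)]
  refine setIntegral_congr_fun hs fun t ht => ?_
  have h0 : 0 ≤ t := hs0 ht
  have h1 : φ t = (1 + t)⁻¹ := by
    simp only [φ]
    rw [projIcc_of_mem zero_le_one ⟨by positivity, inv_le_one_of_one_le₀ (by linarith)⟩]
  have h2 : 1 - (1 + t)⁻¹ + p * (1 + t)⁻¹ = (p + t) / (1 + t) := by
    field_simp
    ring
  rw [h1, h2, ENNReal.toReal_ofReal (mul_nonneg (hρ0 t ht) (by positivity)), smul_eq_mul]
  field_simp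

lemma pos {h : ℝ → ℝ} (hh : IsStieltjes h) {q : ℝ} (hq : 0 < q) (hhq : h q ≠ 0) {p : ℝ}
    (hp : 0 < p) : 0 < h p := by
  obtain ⟨ν, hν⟩ := hh
  have hκ (x : I) := inv_pos.2 (stieltjes_kernel_pos hp x.2)
  rw [hν p hp, integral_pos_iff_support_of_nonneg (fun x => (hκ x).le)
    (integrable_of_continuous_unitInterval (continuous_stieltjes_kernel hp) ν),
    Function.support_eq_univ fun x => (hκ x).ne', Measure.measure_univ_pos]
  intro h0
  exact hhq (by rw [hν q hq, h0, integral_zero_measure])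

lemma rpow_neg {α : ℝ} (h0 : 0 < α) (h1 : α < 1) : IsStieltjes fun p => p ^ (-α) := by
  have hα : 1 - α ∈ Ioo (0 : ℝ) 1 := ⟨by linarith, by linarith⟩
  obtain ⟨μ, hμ⟩ := Real.exists_measure_rpow_eq_integral_rpowIntegrand₀₁ hα
  have heq (p : ℝ) (hp : 0 < p) : EqOn (fun t => Real.rpowIntegrand₀₁ (1 - α) t p)
      (fun t => p * (t ^ (-α) * (p + t)⁻¹)) (Ioi 0) := fun t ht => by
    simp only [Real.rpowIntegrand₀₁_eq_pow_div hα (le_of_lt ht) hp.le]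
    rw [show 1 - α - 1 = -α by ring, div_eq_mul_inv, add_comm t]
    ring
  refine (of_integral (τ := μ) (ρ := fun t => t ^ (-α)) measurableSet_Ioi
    (Ioi_subset_Ici_self) (by fun_prop) (fun t ht => Real.rpow_nonneg (le_of_lt ht) _) ?_).congr
    fun p hp => ?_
  · exact ((hμ 1 (mem_Ici.2 zero_le_one)).1.congr_fun (heq 1 one_pos) measurableSet_Ioi).congr
      (by simp)
  · have h := (hμ p hp.le).2
    rw [setIntegral_congr_fun measurableSet_Ioi (heq p hp), integral_const_mul,
      sub_eq_add_neg, Real.rpow_add hp, Real.rpow_one] at h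
    exact mul_left_cancel₀ hp.ne' h

end IsStieltjes

open ProbabilityTheory in
/-- A Stieltjes function vanishing at infinity is the Laplace transform of a completely monotone
function. -/
lemma IsStieltjes.exists_completelyMonotone {f : ℝ → ℝ} (hf : IsStieltjes f)
    (hlim : Tendsto f atTop (𝓝 0)) :
    ∃ g : ℝ → ℝ, CompletelyMonotone g ∧ (∀ s, 0 ≤ g s) ∧
      ∀ p, 0 < p → IntegrableOn (fun s => Real.exp (-p * s) * g s) (Ioi 0) ∧
        ∫ s in Ioi 0, Real.exp (-p * s) * g s = f p := by
  obtain ⟨ν, hν⟩ := hf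
  have hae : ∀ᵐ x : I ∂(ν : Measure I), (0 : ℝ) < x := by
    have hle : (ν : Measure I).real {0} ≤ 0 := by
      refine ge_of_tendsto hlim ?_
      filter_upwards [eventually_gt_atTop 0] with p hp
      rw [hν p hp, ← integral_indicator_one (measurableSet_singleton 0)]
      refine integral_mono ((integrable_const (1 : ℝ)).indicator (measurableSet_singleton 0))
        (integrable_of_continuous_unitInterval (continuous_stieltjes_kernel hp) ν) fun x => ?_
      have hκ := stieltjes_kernel_pos hp x.2
      by_cases hx : x = 0
      · simp [hx]
      · rw [indicator_of_notMem (by simpa using hx)]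
        positivity
    have h0 : (ν : Measure I) {0} = 0 := by
      have := le_antisymm hle measureReal_nonneg
      rwa [measureReal_eq_zero_iff] at this
    rw [ae_iff]
    convert h0
    ext x
    simp
  let X : I → ℝ := fun x => -((1 - (x : ℝ)) / x)
  have hX : Measurable X := by fun_prop
  let τ : Measure I := (ν : Measure I).withDensity fun x => ENNReal.ofReal (x : ℝ)⁻¹
  have hτ (F : I → ℝ) : ∫ x, F x ∂τ = ∫ x : I, (x : ℝ)⁻¹ * F x ∂(ν : Measure I) := by
    rw [integral_withDensity_eq_integral_toReal_smul (by fun_prop) (by simp)]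
    refine integral_congr_ae (.of_forall fun x => ?_)
    simp [x.2.1]
  have hexp (t : ℝ) (ht : 0 < t) : Integrable (fun x => Real.exp (t * X x)) τ := by
    rw [integrable_withDensity_iff_integrable_smul' (by fun_prop) (by simp)]
    refine Integrable.of_bound (by fun_prop) (Real.exp t / t) (.of_forall fun x => ?_)
    rw [smul_eq_mul, Real.norm_of_nonneg (by positivity),
      ENNReal.toReal_ofReal (inv_nonneg.2 x.2.1)]
    rcases x.2.1.eq_or_lt with hx | hx
    · rw [← hx, inv_zero, zero_mul]
      positivity
    · have h1 : t * X x = t - t * (x : ℝ)⁻¹ := by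
        simp only [X]
        field_simp
        ring
      have h2 : t * (x : ℝ)⁻¹ ≤ Real.exp (t * (x : ℝ)⁻¹) := by
        linarith [Real.add_one_le_exp (t * (x : ℝ)⁻¹)]
      rw [h1, Real.exp_sub, mul_div_left_comm, div_eq_mul_inv _ t]
      refine mul_le_mul_of_nonneg_left ?_ (Real.exp_pos t).le
      rwa [div_le_iff₀ (Real.exp_pos _), le_inv_mul_iff₀ ht]
  have hint : Ioi 0 ⊆ interior (integrableExpSet X τ) :=
    interior_maximal (fun t (ht : 0 < t) => hexp t ht) isOpen_Ioi
  have hX0 (x : I) : 0 ≤ -X x := by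
    simp only [X, neg_neg]
    exact div_nonneg (sub_nonneg.2 x.2.2) x.2.1
  refine ⟨mgf X τ, ⟨(analyticOnNhd_mgf.mono hint).contDiffOn (uniqueDiffOn_Ioi 0),
    fun n t ht => ?_⟩, fun s => mgf_nonneg, fun p hp => ?_⟩
  · rw [iteratedDeriv_mgf (hint ht), ← integral_const_mul]
    refine integral_nonneg fun x => ?_
    beta_reduce
    rw [← mul_assoc, ← mul_pow, neg_one_mul]
    exact mul_nonneg (pow_nonneg (hX0 x) n) (Real.exp_pos _).le
  · let F : ℝ × I → ℝ := fun z => Real.exp (-p * z.1) * ((z.2 : ℝ)⁻¹ * Real.exp (z.1 * X z.2))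
    have hFm : Measurable F := by fun_prop
    have hF0 (z) : 0 ≤ F z := by
      have := z.2.2.1
      positivity
    have hFeq (x : I) : (fun s => F (s, x)) = fun s => (x : ℝ)⁻¹ * Real.exp (-(p - X x) * s) := by
      ext s
      simp only [F]
      rw [mul_left_comm, ← Real.exp_add]
      ring_nf
    have hpX (x : I) : 0 < p - X x := by linarith [hX0 x]
    have hFs (x : I) : IntegrableOn (fun s => F (s, x)) (Ioi 0) := by
      rw [hFeq]
      exact (integrableOn_exp_mul_Ioi (by linarith [hpX x]) 0).const_mul _
    have hFi : ∀ᵐ x : I ∂(ν : Measure I), ∫ s in Ioi 0, F (s, x) = (1 - (x : ℝ) + p * x)⁻¹ := by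
      filter_upwards [hae] with x hx
      have := stieltjes_kernel_pos hp x.2
      have h2 : p - X x = (1 - x + p * x) / x := by
        simp only [X]
        field_simp
        ring
      rw [hFeq, integral_const_mul, integral_exp_mul_Ioi (by linarith [hpX x]), h2]
      field_simp
      simp
    have hFint : Integrable F ((volume.restrict (Ioi 0)).prod (ν : Measure I)) := by
      rw [integrable_prod_iff' hFm.aestronglyMeasurable]
      refine ⟨.of_forall hFs, ?_⟩
      simp_rw [Real.norm_of_nonneg (hF0 _)]
      exact (integrable_of_continuous_unitInterval (continuous_stieltjes_kernel hp) ν).congr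
        (hFi.mono fun x hx => hx.symm)
    have hg : (fun s => Real.exp (-p * s) * mgf X τ s) = fun s => ∫ x, F (s, x) ∂(ν : Measure I) := by
      ext s
      rw [mgf, hτ, ← integral_const_mul]
    rw [hg]
    refine ⟨hFint.integral_prod_left, ?_⟩
    rw [hν p hp, ← integral_congr_ae hFi]
    exact integral_integral_swap hFint

end Stieltjes

/-- Under assumption (*) and for `0 < γ ≤ 1`, there is a completely
monotone function `g_γ ≥ 0` with Laplace transform `(pK(p))^{-γ/2}` (i.e. the
Stieltjes representation of `p ↦ (pK(p))^{-γ/2}` has vanishing constant terms),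
and `∫₀ᵗ g_γ(τ) dτ → 0` as `t → 0+`. -/
theorem statement9
    (k K : ℝ → ℝ) (σ : MeasureTheory.Measure ℝ)
    (hk_nonneg : ∀ t, 0 < t → 0 ≤ k t)
    (hk_loc : ∀ T, 0 < T → MeasureTheory.IntegrableOn k (Set.Ioc 0 T))
    (hK_int : ∀ p, 0 < p →
      MeasureTheory.IntegrableOn (fun t => Real.exp (-p * t) * k t) (Set.Ioi 0))
    (hK_def : ∀ p, 0 < p → K p = ∫ t in Set.Ioi 0, Real.exp (-p * t) * k t)
    (hσ_int : MeasureTheory.IntegrableOn (fun t => (1 + t)⁻¹) (Set.Ici 0) σ)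
    (hK_st : ∀ p, 0 < p → K p = ∫ t in Set.Ici 0, (p + t)⁻¹ ∂σ)
    (hK_zero : Filter.Tendsto K (nhdsWithin 0 (Set.Ioi 0)) Filter.atTop)
    (hK_inf : Filter.Tendsto K Filter.atTop (nhds 0))
    (hpK_zero : Filter.Tendsto (fun p => p * K p) (nhdsWithin 0 (Set.Ioi 0)) (nhds 0))
    (hpK_inf : Filter.Tendsto (fun p => p * K p) Filter.atTop Filter.atTop)
    (γ : ℝ) (hγ0 : 0 < γ) (hγ1 : γ ≤ 1) :
    ∃ g : ℝ → ℝ,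
      CompletelyMonotone g ∧
      (∀ s, 0 < s → 0 ≤ g s) ∧
      (∀ T, 0 < T → IntegrableOn g (Set.Ioc 0 T)) ∧
      (∀ p, 0 < p →
        IntegrableOn (fun s => Real.exp (-p * s) * g s) (Set.Ioi 0)) ∧
      (∀ p, 0 < p →
        ∫ s in Set.Ioi 0, Real.exp (-p * s) * g s = (p * K p) ^ (-(γ / 2))) ∧
      Filter.Tendsto (fun t => ∫ τ in Set.Ioc 0 t, g τ)
        (nhdsWithin 0 (Set.Ioi 0)) (nhds 0) := by
  have hK : IsStieltjes K :=
    (IsStieltjes.of_integral (ρ := fun _ => 1) measurableSet_Ici subset_rfl measurable_const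
      (fun _ _ => zero_le_one) (by simpa using hσ_int)).congr fun p hp => by simpa using hK_st p hp
  obtain ⟨q, hq, hq0⟩ := ((hpK_inf.eventually_gt_atTop 0).and (eventually_gt_atTop 0)).exists
  have hf := (IsStieltjes.rpow_neg (α := γ / 2) (by linarith) (by linarith)).comp_mul hK
    fun p hp => hK.pos hq0 (right_ne_zero_of_mul hq.ne') hp
  obtain ⟨g, hg, hg0, hgL⟩ := hf.exists_completelyMonotone
    ((tendsto_rpow_neg_atTop (half_pos hγ0)).comp hpK_inf)
  have hloc (T : ℝ) : IntegrableOn g (Ioc 0 T) := by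
    have h1 : IntegrableOn (fun s => Real.exp s * (Real.exp (-1 * s) * g s)) (Ioc 0 T) := by
      refine ((hgL 1 one_pos).1.mono_set Ioc_subset_Ioi_self).bdd_mul (c := Real.exp T)
        (by fun_prop) ?_
      filter_upwards [ae_restrict_mem measurableSet_Ioc] with s hs
      rw [Real.norm_of_nonneg (Real.exp_pos s).le]
      exact Real.exp_le_exp.2 hs.2
    refine h1.congr_fun (fun s _ => ?_) measurableSet_Ioc
    simp [← mul_assoc, ← Real.exp_add]
  refine ⟨g, hg, fun s _ => hg0 s, fun T _ => hloc T, fun p hp => (hgL p hp).1,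
    fun p hp => (hgL p hp).2, ?_⟩
  have h1 : Tendsto (fun t : ℝ => volume.restrict (Ioc 0 1) (Ioc 0 t)) (𝓝[>] 0) (𝓝 0) := by
    have h2 : Tendsto (fun t : ℝ => ENNReal.ofReal t) (𝓝[>] 0) (𝓝 0) := by
      simpa using (ENNReal.continuous_ofReal.tendsto 0).mono_left nhdsWithin_le_nhds
    refine tendsto_of_tendsto_of_tendsto_of_le_of_le tendsto_const_nhds h2
      (fun _ => zero_le) fun t => ?_
    exact (Measure.restrict_apply_le _ _).trans (by simp)
  refine (Integrable.tendsto_setIntegral_nhds_zero (hloc 1) h1).congr' ?_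
  filter_upwards [Ioo_mem_nhdsGT (zero_lt_one' ℝ)] with t ht
  rw [Measure.restrict_restrict measurableSet_Ioc,
    inter_eq_left.2 (Ioc_subset_Ioc_right ht.2.le)]
end

section
/- Let k : (0,∞) → [0,∞) be locally integrable, nonzero on a set of positive Lebesgue measure, and suppose its Laplace transform K(p) = ∫₀^∞ e^{−pt} k(t) dt exists for all p > 0. Let w(t,x), t ≥ 0, x ∈ ℝⁿ, be polynomially bounded (|w(t,x)| ≤ P(|x|) for some polynomial P independent of t), continuous in t on [0,∞) uniformly in x, with w(0,x) ≡ 0, and such that for each p > 0 the Laplace transform w̃(p,x) = ∫₀^∞ e^{−pt} w(t,x) dt is twice continuously differentiable in x and satisfies Δ_x w̃(p,x) = p·K(p)·w̃(p,x) for all x ∈ ℝⁿ. Then w(t,x) ≡ 0. -/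
open MeasureTheory Filter Set

/-- The Laplacian of `f : ℝⁿ → ℝ` at `x`: the sum of the pure second partial
derivatives in the coordinate directions. -/
noncomputable def lap {n : ℕ} (f : EuclideanSpace ℝ (Fin n) → ℝ)
    (x : EuclideanSpace ℝ (Fin n)) : ℝ :=
  ∑ i : Fin n,
    iteratedFDeriv ℝ 2 f x ![EuclideanSpace.single i 1, EuclideanSpace.single i 1]

open Topology Polynomial

theorem deriv_deriv_nonpos_of_isLocalMax {g : ℝ → ℝ} {a : ℝ} (hmax : IsLocalMax g a)
    (hc : ContinuousAt g a) : deriv (deriv g) a ≤ 0 := by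
  by_contra! hpos
  have hmin : IsLocalMin g a := isLocalMin_of_deriv_deriv_pos hpos hmax.deriv_eq_zero hc
  have hconst : g =ᶠ[𝓝 a] fun _ => g a := by
    filter_upwards [hmax, hmin] with y h₁ h₂ using le_antisymm h₁ h₂
  have hderiv : deriv (deriv g) a = 0 := by
    rw [hconst.deriv.deriv_eq]
    simp
  exact hpos.ne' hderiv

section Line

variable {E : Type*} [NormedAddCommGroup E] [NormedSpace ℝ E] {f : E → ℝ}

theorem ContDiff.hasDerivAt_line (hf : ContDiff ℝ 2 f) (x v : E) (s : ℝ) :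
    HasDerivAt (fun s : ℝ => f (x + s • v)) (fderiv ℝ f (x + s • v) v) s := by
  have hline : HasDerivAt (fun s : ℝ => x + s • v) v s := by
    simpa using ((hasDerivAt_id s).smul_const v).const_add x
  exact ((hf.differentiable (by norm_num)) (x + s • v)).hasFDerivAt.comp_hasDerivAt s hline

theorem ContDiff.hasDerivAt_fderiv_line (hf : ContDiff ℝ 2 f) (x v : E) :
    HasDerivAt (fun s : ℝ => fderiv ℝ f (x + s • v) v)
      (iteratedFDeriv ℝ 2 f x ![v, v]) 0 := by
  have hline : HasDerivAt (fun s : ℝ => x + s • v) v 0 := by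
    simpa using ((hasDerivAt_id (0 : ℝ)).smul_const v).const_add x
  have hdiff : Differentiable ℝ (fderiv ℝ f) :=
    (hf.fderiv_right (m := 1) (by norm_num)).differentiable (by norm_num)
  have hfd : HasFDerivAt (fderiv ℝ f) (fderiv ℝ (fderiv ℝ f) x) (x + (0 : ℝ) • v) := by
    simpa using (hdiff x).hasFDerivAt
  have hcomp := hfd.comp_hasDerivAt (0 : ℝ) hline
  rw [iteratedFDeriv_two_apply]
  simpa using hcomp.clm_apply (hasDerivAt_const (0 : ℝ) v)

end Line

/-- A second derivative test in one coordinate direction for a maximum of `f - ε ∑ cosh (c xⱼ)`. -/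
theorem iteratedFDeriv_two_le_of_forall_sub_cosh_le {n : ℕ} {f : EuclideanSpace ℝ (Fin n) → ℝ}
    (hf : ContDiff ℝ 2 f) (ε c : ℝ) (x : EuclideanSpace ℝ (Fin n))
    (hmax : ∀ y, f y - ε * ∑ j, Real.cosh (c * y j) ≤ f x - ε * ∑ j, Real.cosh (c * x j))
    (i : Fin n) :
    iteratedFDeriv ℝ 2 f x ![EuclideanSpace.single i 1, EuclideanSpace.single i 1]
      ≤ ε * (c ^ 2 * Real.cosh (c * x i)) := by
  set v : EuclideanSpace ℝ (Fin n) := EuclideanSpace.single i 1 with hv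
  let g : ℝ → ℝ := fun s => f (x + s • v) - ε * Real.cosh (c * (x i + s))
  have hlin (s : ℝ) : HasDerivAt (fun s => c * (x i + s)) c s := by
    simpa using ((hasDerivAt_id s).const_add (x i)).const_mul c
  have hg (s : ℝ) : HasDerivAt g
      (fderiv ℝ f (x + s • v) v - ε * (Real.sinh (c * (x i + s)) * c)) s :=
    (hf.hasDerivAt_line x v s).sub ((hlin s).cosh.const_mul ε)
  have hg' : HasDerivAt (deriv g)
      (iteratedFDeriv ℝ 2 f x ![v, v] - ε * (Real.cosh (c * (x i + 0)) * c * c)) 0 := by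
    rw [funext fun s => (hg s).deriv]
    exact (hf.hasDerivAt_fderiv_line x v).sub (((hlin 0).sinh.mul_const c).const_mul ε)
  have hsum (s : ℝ) : ∑ j, Real.cosh (c * (x + s • v) j) =
      ∑ j, Real.cosh (c * x j) + (Real.cosh (c * (x i + s)) - Real.cosh (c * x i)) := by
    rw [← Finset.add_sum_erase _ _ (Finset.mem_univ i),
      ← Finset.add_sum_erase (a := i) _ (fun j => Real.cosh (c * x j)) (Finset.mem_univ i)]
    have hrest : ∑ j ∈ Finset.univ.erase i, Real.cosh (c * (x + s • v) j) =
        ∑ j ∈ Finset.univ.erase i, Real.cosh (c * x j) := by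
      refine Finset.sum_congr rfl fun j hj => ?_
      simp [hv, Finset.ne_of_mem_erase hj]
    rw [hrest]
    simp [hv]
    ring
  have hloc : IsLocalMax g 0 := by
    refine Filter.Eventually.of_forall fun s => ?_
    have h := hmax (x + s • v)
    rw [hsum s] at h
    simp only [g, zero_smul, add_zero]
    linarith
  have hnonpos := deriv_deriv_nonpos_of_isLocalMax hloc (hg 0).continuousAt
  rw [hg'.deriv, add_zero] at hnonpos
  linarith

theorem Polynomial.eventually_eval_le_mul_exp (P : ℝ[X]) {b δ : ℝ} (hb : 0 < b) (hδ : 0 < δ) :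
    ∀ᶠ r in atTop, P.eval r ≤ δ * Real.exp (b * r) := by
  have hlim := ((P.comp (C b⁻¹ * X)).tendsto_div_exp_atTop).comp
    (tendsto_id.const_mul_atTop hb)
  filter_upwards [hlim.eventually (eventually_lt_nhds hδ)] with r hr
  have hcancel : b⁻¹ * (b * r) = r := by field_simp
  simp only [Function.comp_apply, id, eval_comp, eval_mul, eval_C, eval_X, hcancel] at hr
  exact ((div_lt_iff₀ (Real.exp_pos _)).mp hr).le

theorem exp_norm_le_sum_cosh {n : ℕ} {c : ℝ} (hc : 0 ≤ c) (x : EuclideanSpace ℝ (Fin (n + 1))) :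
    Real.exp (c / (n + 1) * ‖x‖) ≤ 2 * ∑ j, Real.cosh (c * x j) := by
  obtain ⟨i, hi⟩ : ∃ i, ‖x‖ / (n + 1) ≤ |x i| := by
    by_contra! hlt
    have hsum : ∑ i, |x i| < ∑ _i : Fin (n + 1), ‖x‖ / (n + 1) :=
      Finset.sum_lt_sum_of_nonempty Finset.univ_nonempty fun i _ => hlt i
    have hconst : ∑ _i : Fin (n + 1), ‖x‖ / (n + 1) = ‖x‖ := by
      simp
      field_simp
    have hnorm : ‖x‖ ≤ ∑ i, |x i| := by
      rw [EuclideanSpace.norm_eq, Real.sqrt_le_left (Finset.sum_nonneg fun i _ => abs_nonneg _)]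
      exact Finset.sum_sq_le_sq_sum_of_nonneg fun i _ => abs_nonneg _
    linarith
  calc Real.exp (c / (n + 1) * ‖x‖) ≤ Real.exp |c * x i| := by
        rw [Real.exp_le_exp, abs_mul, abs_of_nonneg hc]
        calc c / (n + 1) * ‖x‖ = c * (‖x‖ / (n + 1)) := by ring
          _ ≤ c * |x i| := by gcongr
    _ ≤ 2 * Real.cosh (c * x i) := by
        rw [← Real.cosh_abs, Real.cosh_eq]
        linarith [Real.exp_pos (-|c * x i|)]
    _ ≤ 2 * ∑ j, Real.cosh (c * x j) := by
        gcongr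
        exact Finset.single_le_sum (f := fun j => Real.cosh (c * x j))
          (fun j _ => (Real.cosh_pos _).le) (Finset.mem_univ i)

/-- A one-sided Liouville theorem for the equation `Δu = lam u` with `lam > 0`. -/
theorem nonpos_of_lap_eq_of_le_polynomial {n : ℕ} {u : EuclideanSpace ℝ (Fin n) → ℝ} {lam : ℝ}
    (hlam : 0 < lam) (hu : ContDiff ℝ 2 u) (hlap : ∀ x, lap u x = lam * u x) (P : ℝ[X])
    (hP : ∀ x, u x ≤ P.eval ‖x‖) (x : EuclideanSpace ℝ (Fin n)) : u x ≤ 0 := by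
  cases n with
  | zero =>
    have h := hlap x
    simp only [lap, Finset.univ_eq_empty, Finset.sum_empty] at h
    exact ((mul_eq_zero.mp h.symm).resolve_left hlam.ne').le
  | succ n =>
    set c := √lam
    have hc : 0 < c := Real.sqrt_pos.mpr hlam
    have hc2 : c ^ 2 = lam := Real.sq_sqrt hlam.le
    have hbarrier (ε : ℝ) (hε : 0 < ε) (y : EuclideanSpace ℝ (Fin (n + 1))) :
        u y - ε * ∑ j, Real.cosh (c * y j) ≤ 0 := by
      by_contra! hy
      have hcont : Continuous fun z : EuclideanSpace ℝ (Fin (n + 1)) =>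
          u z - ε * ∑ j, Real.cosh (c * z j) := by
        have := hu.continuous
        fun_prop
      have hfar : ∀ᶠ z in cocompact (EuclideanSpace ℝ (Fin (n + 1))),
          u z - ε * ∑ j, Real.cosh (c * z j) ≤ u y - ε * ∑ j, Real.cosh (c * y j) := by
        filter_upwards [tendsto_norm_cocompact_atTop.eventually
          (P.eventually_eval_le_mul_exp (b := c / (n + 1)) (by positivity) (half_pos hε))] with z hz
        have hexp := exp_norm_le_sum_cosh hc.le z
        have := hP z
        nlinarith
      obtain ⟨z, hz⟩ := hcont.exists_forall_ge' y hfar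
      have hle : lap u z ≤ ∑ i, ε * (c ^ 2 * Real.cosh (c * z i)) :=
        Finset.sum_le_sum fun i _ => iteratedFDeriv_two_le_of_forall_sub_cosh_le hu ε c z hz i
      rw [← Finset.mul_sum, ← Finset.mul_sum, hlap, hc2] at hle
      have hpos : 0 < u z - ε * ∑ j, Real.cosh (c * z j) := hy.trans_le (hz y)
      nlinarith [mul_pos hlam hpos]
    refine le_of_forall_pos_le_add fun δ hδ => ?_
    have hS : 0 < ∑ j, Real.cosh (c * x j) :=
      Finset.sum_pos (fun j _ => Real.cosh_pos _) Finset.univ_nonempty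
    have h := hbarrier (δ / ∑ j, Real.cosh (c * x j)) (by positivity) x
    rw [div_mul_cancel₀ _ hS.ne'] at h
    linarith

theorem lap_neg {n : ℕ} (u : EuclideanSpace ℝ (Fin n) → ℝ) (x : EuclideanSpace ℝ (Fin n)) :
    lap (fun y => -u y) x = -lap u x := by
  simp only [lap, ← Finset.sum_neg_distrib]
  refine Finset.sum_congr rfl fun i _ => ?_
  rw [show (fun y => -u y) = -u from rfl, iteratedFDeriv_neg_apply]
  rfl

theorem eq_zero_of_lap_eq_of_abs_le_polynomial {n : ℕ} {u : EuclideanSpace ℝ (Fin n) → ℝ}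
    {lam : ℝ} (hlam : 0 < lam) (hu : ContDiff ℝ 2 u) (hlap : ∀ x, lap u x = lam * u x)
    (P : ℝ[X]) (hP : ∀ x, |u x| ≤ P.eval ‖x‖) (x : EuclideanSpace ℝ (Fin n)) : u x = 0 := by
  have hle := nonpos_of_lap_eq_of_le_polynomial hlam hu hlap P
    (fun y => (le_abs_self _).trans (hP y)) x
  have hge := nonpos_of_lap_eq_of_le_polynomial (u := fun y => -u y) hlam hu.neg
    (fun y => by rw [lap_neg, hlap]; ring) P (fun y => (neg_le_abs _).trans (hP y)) x
  linarith

/-- A bounded continuous function on `[0, ∞)` with vanishing Laplace transform is zero. -/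
theorem eq_zero_of_laplace_eq_zero {f : ℝ → ℝ} {M : ℝ} (hf : ContinuousOn f (Ici 0))
    (hM : ∀ t, 0 ≤ t → |f t| ≤ M)
    (hL : ∀ p, 0 < p → ∫ t in Ioi 0, Real.exp (-p * t) * f t = 0) (t : ℝ) (ht : 0 < t) :
    f t = 0 := by
  have hM0 : 0 ≤ M := (abs_nonneg _).trans (hM 0 le_rfl)
  have hfm : AEStronglyMeasurable f (volume.restrict (Ioi 0)) :=
    (hf.mono Ioi_subset_Ici_self).aestronglyMeasurable measurableSet_Ioi
  have hint (p : ℝ) (hp : 0 < p) :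
      IntegrableOn (fun t => Real.exp (-p * t) * f t) (Ioi 0) := by
    refine (exp_neg_integrableOn_Ioi 0 hp).mul_bdd (c := M) hfm ?_
    filter_upwards [ae_restrict_mem measurableSet_Ioi] with t ht using hM t (le_of_lt ht)
  have hmem {t : ℝ} (ht : t ∈ Ioi (0 : ℝ)) : Real.exp (-t) ∈ Icc (0 : ℝ) 1 :=
    ⟨(Real.exp_pos _).le, Real.exp_le_one_iff.mpr (neg_nonpos.mpr (le_of_lt ht))⟩
  have hpoly (q : ℝ[X]) :
      IntegrableOn (fun t => Real.exp (-t) * f t * q.eval (Real.exp (-t))) (Ioi 0) ∧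
      ∫ t in Ioi 0, Real.exp (-t) * f t * q.eval (Real.exp (-t)) = 0 := by
    induction q using Polynomial.induction_on' with
    | monomial m a =>
      have heq (t : ℝ) : Real.exp (-t) * f t * (monomial m a).eval (Real.exp (-t)) =
          a * (Real.exp (-((m : ℝ) + 1) * t) * f t) := by
        have hexp : Real.exp (-((m : ℝ) + 1) * t) = Real.exp (-t) ^ m * Real.exp (-t) := by
          rw [← Real.exp_nat_mul, ← Real.exp_add]
          ring_nf
        rw [eval_monomial, hexp]
        ring
      simp only [heq]
      refine ⟨(hint _ (by positivity)).const_mul a, ?_⟩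
      rw [integral_const_mul, hL _ (by positivity), mul_zero]
    | add q r hq hr =>
      simp only [eval_add, mul_add]
      exact ⟨hq.1.add hr.1, by rw [integral_add hq.1 hr.1, hq.2, hr.2, add_zero]⟩
  let h : ℝ → ℝ := fun s => s * f (-Real.log s)
  have hh : ContinuousOn h (Icc 0 1) := by
    intro s hs
    rcases hs.1.eq_or_lt with rfl | hs0
    · have hbound : ∀ᶠ s in 𝓝[Icc 0 1] (0 : ℝ), ‖h s‖ ≤ s * M := by
        filter_upwards [self_mem_nhdsWithin] with s hs
        rw [Real.norm_eq_abs, abs_mul, abs_of_nonneg hs.1]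
        exact mul_le_mul_of_nonneg_left
          (hM _ (neg_nonneg.mpr (Real.log_nonpos hs.1 hs.2))) hs.1
      have hlim : Tendsto (fun s : ℝ => s * M) (𝓝[Icc 0 1] 0) (𝓝 0) := by
        have : Continuous fun s : ℝ => s * M := by fun_prop
        simpa using (this.tendsto 0).mono_left nhdsWithin_le_nhds
      simpa [ContinuousWithinAt, h] using squeeze_zero_norm' hbound hlim
    · have hlog : ContinuousWithinAt (fun s => -Real.log s) (Icc 0 1) s :=
        (Real.continuousAt_log hs0.ne').neg.continuousWithinAt
      exact continuousWithinAt_id.mul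
        (ContinuousWithinAt.comp (f := fun s => -Real.log s)
          (hf _ (neg_nonneg.mpr (Real.log_nonpos hs.1 hs.2))) hlog
          fun r hr => neg_nonneg.mpr (Real.log_nonpos hr.1 hr.2))
  have hhexp (t : ℝ) : h (Real.exp (-t)) = Real.exp (-t) * f t := by
    simp [h]
  set F : ℝ → ℝ := fun t => Real.exp (-t) * f t
  have hFint : IntegrableOn F (Ioi 0) := by
    simpa [F] using hint 1 one_pos
  have hFbdd : ∀ᵐ t ∂volume.restrict (Ioi 0), ‖F t‖ ≤ M := by
    filter_upwards [ae_restrict_mem measurableSet_Ioi] with t ht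
    rw [Real.norm_eq_abs, abs_mul, abs_of_pos (Real.exp_pos _)]
    exact (mul_le_of_le_one_left (abs_nonneg _) (hmem ht).2).trans (hM t (le_of_lt ht))
  have hsqint : IntegrableOn (fun t => F t * F t) (Ioi 0) :=
    hFint.mul_bdd hFint.aestronglyMeasurable hFbdd
  have hsq : ∫ t in Ioi 0, F t * F t = 0 := by
    have hle (ε : ℝ) (hε : 0 < ε) :
        ∫ t in Ioi 0, F t * F t ≤ ε * ∫ t in Ioi 0, |F t| := by
      obtain ⟨q, hq⟩ := exists_polynomial_near_of_continuousOn 0 1 h hh ε hε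
      obtain ⟨hqi, hq0⟩ := hpoly q
      have hsub := integral_sub hsqint hqi
      rw [hq0, sub_zero] at hsub
      rw [← integral_const_mul, ← hsub]
      refine setIntegral_mono_on (hsqint.sub hqi) (hFint.abs.const_mul ε) measurableSet_Ioi
        fun t ht => ?_
      have hqt := hq _ (hmem ht)
      rw [hhexp, abs_sub_comm] at hqt
      calc F t * F t - Real.exp (-t) * f t * q.eval (Real.exp (-t))
          = F t * (F t - q.eval (Real.exp (-t))) := by simp only [F]; ring
        _ ≤ |F t| * |F t - q.eval (Real.exp (-t))| := by
            rw [← abs_mul]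
            exact le_abs_self _
        _ ≤ ε * |F t| := by
            rw [mul_comm ε]
            exact mul_le_mul_of_nonneg_left hqt.le (abs_nonneg _)
    refine le_antisymm ?_ (integral_nonneg fun t => mul_self_nonneg _)
    have hlim : Tendsto (fun ε : ℝ => ε * ∫ t in Ioi 0, |F t|) (𝓝[>] 0) (𝓝 0) := by
      have : Continuous fun ε : ℝ => ε * ∫ t in Ioi 0, |F t| := by fun_prop
      simpa using (this.tendsto 0).mono_left nhdsWithin_le_nhds
    refine ge_of_tendsto hlim ?_
    filter_upwards [self_mem_nhdsWithin] with ε hε using hle ε hε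
  rw [integral_eq_zero_iff_of_nonneg (fun t => mul_self_nonneg _) hsqint] at hsq
  have hFcont : ContinuousOn F (Ioi 0) :=
    (Real.continuous_exp.comp continuous_neg).continuousOn.mul (hf.mono Ioi_subset_Ici_self)
  have hzero := Measure.eqOn_open_of_ae_eq hsq isOpen_Ioi (hFcont.mul hFcont)
    continuousOn_const (mem_Ioi.mpr ht)
  exact (mul_eq_zero.mp (mul_self_eq_zero.mp hzero)).resolve_left (Real.exp_pos _).ne'

theorem laplace_pos {k : ℝ → ℝ} {p : ℝ} (hk : ∀ t, 0 < t → 0 ≤ k t)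
    (hne : ¬ ∀ᵐ t ∂volume.restrict (Ioi 0), k t = 0)
    (hint : IntegrableOn (fun t => Real.exp (-p * t) * k t) (Ioi 0)) :
    0 < ∫ t in Ioi 0, Real.exp (-p * t) * k t := by
  have hnonneg : 0 ≤ᵐ[volume.restrict (Ioi 0)] fun t => Real.exp (-p * t) * k t := by
    filter_upwards [ae_restrict_mem measurableSet_Ioi] with t ht
    exact mul_nonneg (Real.exp_pos _).le (hk t ht)
  refine (integral_nonneg_of_ae hnonneg).lt_of_ne' fun h => hne ?_
  filter_upwards [(setIntegral_eq_zero_iff_of_nonneg_ae hnonneg hint).mp h] with t ht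
  exact (mul_eq_zero.mp ht).resolve_left (Real.exp_pos _).ne'

theorem abs_laplace_le {f : ℝ → ℝ} {M p : ℝ} (hp : 0 < p) (hM : ∀ t, 0 ≤ t → |f t| ≤ M) :
    |∫ t in Ioi 0, Real.exp (-p * t) * f t| ≤ p⁻¹ * M := by
  have hbound : ‖∫ t in Ioi 0, Real.exp (-p * t) * f t‖ ≤
      ∫ t in Ioi 0, Real.exp (-p * t) * M := by
    refine norm_integral_le_of_norm_le ((exp_neg_integrableOn_Ioi 0 hp).mul_const M) ?_
    filter_upwards [ae_restrict_mem measurableSet_Ioi] with t ht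
    rw [Real.norm_eq_abs, abs_mul, abs_of_pos (Real.exp_pos _)]
    exact mul_le_mul_of_nonneg_left (hM t (le_of_lt ht)) (Real.exp_pos _).le
  rw [integral_mul_const, integral_exp_mul_Ioi (neg_neg_iff_pos.mpr hp)] at hbound
  simpa [neg_div_neg_eq] using hbound

/-- uniqueness of polynomially bounded LT-solutions. Let
`k : (0,∞) → [0,∞)` be locally integrable, nonzero on a set of positive measure,
with Laplace transform `K(p)` existing for all `p > 0`. Let `w(t,x)` be polynomially
bounded (uniformly in `t`), continuous in `t` on `[0,∞)` uniformly in `x`, with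
`w(0,·) ≡ 0`, such that for each `p > 0` its Laplace transform
`w̃(p,x) = ∫₀^∞ e^{-pt} w(t,x) dt` is twice continuously differentiable in `x` and
satisfies `Δ_x w̃(p,x) = p K(p) w̃(p,x)`. Then `w ≡ 0`. -/
theorem statement10
    (n : ℕ)
    (k K : ℝ → ℝ)
    (hk_nonneg : ∀ t, 0 < t → 0 ≤ k t)
    (hk_loc : ∀ T, 0 < T → IntegrableOn k (Set.Ioc 0 T))
    (hk_ne : ¬ (∀ᵐ t ∂(volume.restrict (Set.Ioi 0)), k t = 0))
    (hK_int : ∀ p, 0 < p →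
      IntegrableOn (fun t => Real.exp (-p * t) * k t) (Set.Ioi 0))
    (hK_def : ∀ p, 0 < p → K p = ∫ t in Set.Ioi 0, Real.exp (-p * t) * k t)
    (w : ℝ → EuclideanSpace ℝ (Fin n) → ℝ)
    (P : Polynomial ℝ)
    (hw_poly : ∀ t, 0 ≤ t → ∀ x, |w t x| ≤ P.eval ‖x‖)
    (hw_cont : ∀ t₀, 0 ≤ t₀ → ∀ ε, 0 < ε → ∃ δ > 0,
      ∀ t, 0 ≤ t → |t - t₀| < δ → ∀ x, |w t x - w t₀ x| ≤ ε)
    (hw_zero : ∀ x, w 0 x = 0)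
    (hLT_int : ∀ p, 0 < p → ∀ x,
      IntegrableOn (fun t => Real.exp (-p * t) * w t x) (Set.Ioi 0))
    (hLT_C2 : ∀ p, 0 < p →
      ContDiff ℝ 2 (fun x => ∫ t in Set.Ioi 0, Real.exp (-p * t) * w t x))
    (hLT_eq : ∀ p, 0 < p → ∀ x,
      lap (fun y => ∫ t in Set.Ioi 0, Real.exp (-p * t) * w t y) x
        = p * K p * ∫ t in Set.Ioi 0, Real.exp (-p * t) * w t x) :
    ∀ t, 0 ≤ t → ∀ x, w t x = 0 := by
  have hLT_zero (p : ℝ) (hp : 0 < p) (x : EuclideanSpace ℝ (Fin n)) :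
      ∫ t in Set.Ioi 0, Real.exp (-p * t) * w t x = 0 := by
    have hK : 0 < K p := by
      rw [hK_def p hp]
      exact laplace_pos hk_nonneg hk_ne (hK_int p hp)
    refine eq_zero_of_lap_eq_of_abs_le_polynomial (mul_pos hp hK) (hLT_C2 p hp) (hLT_eq p hp)
      (C p⁻¹ * P) (fun y => ?_) x
    rw [eval_mul, eval_C]
    exact abs_laplace_le hp fun t ht => hw_poly t ht y
  intro t ht x
  rcases ht.eq_or_lt with rfl | ht
  · exact hw_zero x
  have hcont : ContinuousOn (fun t => w t x) (Ici 0) := by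
    rw [Metric.continuousOn_iff]
    intro t₀ ht₀ ε hε
    obtain ⟨δ, hδ, h⟩ := hw_cont t₀ ht₀ (ε / 2) (half_pos hε)
    exact ⟨δ, hδ, fun t ht htδ => (h t ht htδ x).trans_lt (half_lt_self hε)⟩
  exact eq_zero_of_laplace_eq_zero hcont (fun t ht => hw_poly t ht x)
    (fun p hp => hLT_zero p hp x) t ht
end

section
/- Let σ be a Borel measure on (0,∞) with ∫₀^∞ (1+t)^{−1} σ(dt) < ∞, and define m(t) = ∫₀^∞ e^{−ts}·s σ(ds) for t > 0. Then m is completely monotone, ∫₀^∞ min(1,t)·m(t) dt < ∞, and for every λ > 0 one has ∫₀^∞ (1 − e^{−λt}) m(t) dt = ∫₀^∞ λ/(λ+t) σ(dt). In other words, the complete Bernstein function with Stieltjes-type representation a + bλ + ∫ λ/(λ+t) σ(dt) has Lévy density m(t) = ∫ e^{−ts} s σ(ds). -/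
open MeasureTheory Filter Set

/-- A negative exponential is dominated by a multiple of `(1 + s)⁻¹`. -/
theorem exp_neg_mul_le_inv_one_add {t s : ℝ} (ht : 0 < t) (hs : 0 < s) :
    Real.exp (-t * s) ≤ (min 1 t)⁻¹ * (1 + s)⁻¹ := by
  have hmin : 0 < min 1 t := lt_min one_pos ht
  rw [← mul_inv, neg_mul, Real.exp_neg]
  refine inv_anti₀ (by positivity) ?_
  have h1 : min 1 t * s ≤ t * s := by gcongr; exact min_le_right _ _
  linarith [Real.add_one_le_exp (t * s), min_le_left 1 t]

theorem min_one_le_two_mul_one_sub_exp_neg {t : ℝ} (ht : 0 < t) :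
    min 1 t ≤ 2 * (1 - Real.exp (-t)) := by
  have h1 : Real.exp (-t) ≤ (1 + t)⁻¹ := by
    rw [Real.exp_neg]
    exact inv_anti₀ (by positivity) (by linarith [Real.add_one_le_exp t])
  have h2 : min 1 t ≤ 2 * (1 - (1 + t)⁻¹) := by
    have h3 : 1 - (1 + t)⁻¹ = t / (1 + t) := by field_simp; ring
    rw [h3, ← mul_div_assoc, le_div_iff₀ (by positivity)]
    rcases le_total 1 t with h | h
    · rw [min_eq_left h]; linarith
    · rw [min_eq_right h]; nlinarith
  linarith

/-- A measure for which `(1 + s)⁻¹` is integrable on `(0, ∞)` is σ-finite there. -/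
theorem sigmaFinite_restrict_Ioi_of_integrableOn_inv {σ : Measure ℝ}
    (hσ : IntegrableOn (fun s => (1 + s)⁻¹) (Ioi 0) σ) :
    SigmaFinite (σ.restrict (Ioi 0)) := by
  have hf := hσ.aefinStronglyMeasurable
  have h0 : (fun s : ℝ => (1 + s)⁻¹) =ᵐ[(σ.restrict (Ioi 0)).restrict hf.sigmaFiniteSetᶜ] 0 :=
    hf.ae_eq_zero_compl
  have hmem : ∀ᵐ s ∂(σ.restrict (Ioi 0)), s ∈ hf.sigmaFiniteSet := by
    filter_upwards [(ae_restrict_iff' hf.measurableSet.compl).1 h0,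
      ae_restrict_mem measurableSet_Ioi] with s hs hs0
    by_contra hns
    have hpos : (0 : ℝ) < (1 + s)⁻¹ := inv_pos.2 (by linarith [mem_Ioi.1 hs0])
    exact hpos.ne' (hs hns)
  have := hf.sigmaFinite_restrict
  rwa [Measure.restrict_eq_self_of_ae_mem hmem] at this

/-- The Laplace transform of `s σ(ds)` is completely monotone. -/
theorem completelyMonotone_laplace {σ : Measure ℝ}
    (hσ : IntegrableOn (fun s => (1 + s)⁻¹) (Ioi 0) σ) {m : ℝ → ℝ}
    (hm : ∀ t, 0 < t → m t = ∫ s in Ioi 0, Real.exp (-t * s) * s ∂σ) :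
    CompletelyMonotone m := by
  set μ := σ.restrict (Ioi 0)
  have hexp : Iio 0 ⊆ ProbabilityTheory.integrableExpSet id μ := by
    intro t ht
    have ht' : 0 < -t := neg_pos.2 ht
    refine Integrable.mono' (hσ.const_mul (min 1 (-t))⁻¹) (by fun_prop) ?_
    filter_upwards [ae_restrict_mem measurableSet_Ioi] with s hs
    simpa using exp_neg_mul_le_inv_one_add ht' hs
  have hint : ∀ t, 0 < t → -t ∈ interior (ProbabilityTheory.integrableExpSet id μ) := fun t ht =>
    interior_maximal hexp isOpen_Iio (mem_Iio.2 (neg_lt_zero.2 ht))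
  have heq : EqOn m (fun t => deriv (ProbabilityTheory.mgf id μ) (-t)) (Ioi 0) := by
    intro t ht
    have h := ProbabilityTheory.deriv_mgf (hint t ht)
    simp only [h, hm t ht, id, mul_comm, μ]
  refine ⟨?_, fun n t ht => ?_⟩
  · refine ContDiffOn.congr (fun t ht => ContDiffAt.contDiffWithinAt ?_) heq
    have h := (ProbabilityTheory.analyticAt_mgf
      (hint t ht)).deriv.contDiffAt (n := (⊤ : ℕ∞))
    exact h.comp t contDiff_neg.contDiffAt
  · rw [heq.iteratedDeriv_of_isOpen isOpen_Ioi n ht, iteratedDeriv_comp_neg, smul_eq_mul,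
      ← mul_assoc, ← mul_pow, neg_one_mul, neg_neg, one_pow, one_mul, ← iteratedDeriv_succ',
      ProbabilityTheory.iteratedDeriv_mgf (hint t ht)]
    refine integral_nonneg_of_ae ?_
    filter_upwards [ae_restrict_mem measurableSet_Ioi] with s hs
    exact mul_nonneg (pow_nonneg (le_of_lt hs) _) (Real.exp_nonneg _)

theorem integrableOn_one_sub_exp_mul_exp_mul {l s : ℝ} (hl : 0 < l) (hs : 0 < s) :
    IntegrableOn (fun t => (1 - Real.exp (-l * t)) * (Real.exp (-t * s) * s)) (Ioi 0) := by
  have h1 := (integrableOn_exp_mul_Ioi (neg_lt_zero.2 hs) 0).mul_const s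
  have h2 := (integrableOn_exp_mul_Ioi (a := -(l + s)) (by linarith) 0).mul_const s
  refine (h1.sub h2).congr (ae_of_all _ fun t => ?_)
  have h3 : Real.exp (-(l + s) * t) = Real.exp (-l * t) * Real.exp (-t * s) := by
    rw [← Real.exp_add]; ring_nf
  have h4 : Real.exp (-s * t) = Real.exp (-t * s) := by ring_nf
  simp only [Pi.sub_apply, h3, h4]
  ring

theorem integral_one_sub_exp_mul_exp_mul {l s : ℝ} (hl : 0 < l) (hs : 0 < s) :
    ∫ t in Ioi 0, (1 - Real.exp (-l * t)) * (Real.exp (-t * s) * s) = l / (l + s) := by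
  have h1 := (integrableOn_exp_mul_Ioi (neg_lt_zero.2 hs) 0).mul_const s
  have h2 := (integrableOn_exp_mul_Ioi (a := -(l + s)) (by linarith) 0).mul_const s
  have h : ∀ t : ℝ, (1 - Real.exp (-l * t)) * (Real.exp (-t * s) * s) =
      Real.exp (-s * t) * s - Real.exp (-(l + s) * t) * s := fun t => by
    have h3 : Real.exp (-(l + s) * t) = Real.exp (-l * t) * Real.exp (-t * s) := by
      rw [← Real.exp_add]; ring_nf
    have h4 : Real.exp (-s * t) = Real.exp (-t * s) := by ring_nf
    rw [h3, h4]
    ring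
  simp_rw [h]
  rw [integral_sub h1 h2, integral_mul_const, integral_mul_const,
    integral_exp_mul_Ioi (neg_lt_zero.2 hs), integral_exp_mul_Ioi (by linarith)]
  have : l + s ≠ 0 := by positivity
  simp only [mul_zero, Real.exp_zero]
  field_simp
  ring

/-- Joint integrability of the kernel relating the Lévy and Stieltjes representations. -/
theorem integrable_one_sub_exp_mul_exp_mul_prod {σ : Measure ℝ}
    (hσ : IntegrableOn (fun s => (1 + s)⁻¹) (Ioi 0) σ) {l : ℝ} (hl : 0 < l) :
    Integrable (Function.uncurry fun t s : ℝ =>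
        (1 - Real.exp (-l * t)) * (Real.exp (-t * s) * s))
      ((volume.restrict (Ioi 0)).prod (σ.restrict (Ioi 0))) := by
  have := sigmaFinite_restrict_Ioi_of_integrableOn_inv hσ
  rw [integrable_prod_iff' (Continuous.aestronglyMeasurable
    (by unfold Function.uncurry; fun_prop))]
  refine ⟨?_, ?_⟩
  · filter_upwards [ae_restrict_mem measurableSet_Ioi] with s hs
    exact integrableOn_one_sub_exp_mul_exp_mul hl hs
  · have hbound : Integrable (fun s => l / (l + s)) (σ.restrict (Ioi 0)) := by
      refine Integrable.mono' (hσ.const_mul (l * (min 1 l)⁻¹))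
        (Measurable.aestronglyMeasurable (by fun_prop)) ?_
      filter_upwards [ae_restrict_mem measurableSet_Ioi] with s hs
      have hs' : 0 < s := hs
      have hmin : 0 < min 1 l := lt_min one_pos hl
      rw [Real.norm_of_nonneg (by positivity), div_eq_mul_inv, mul_assoc, ← mul_inv]
      gcongr
      nlinarith [min_le_left 1 l, min_le_right 1 l]
    refine hbound.congr ?_
    filter_upwards [ae_restrict_mem measurableSet_Ioi] with s hs
    rw [← integral_one_sub_exp_mul_exp_mul hl hs]
    refine setIntegral_congr_fun measurableSet_Ioi fun t ht => ?_
    have h1 : Real.exp (-l * t) ≤ 1 := Real.exp_le_one_iff.2 (by nlinarith [mem_Ioi.1 ht])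
    exact (Real.norm_of_nonneg (mul_nonneg (by linarith)
      (mul_nonneg (Real.exp_nonneg _) (le_of_lt hs)))).symm

/-- Let `σ` be a Borel measure on `(0,∞)` with
`∫ (1+t)⁻¹ σ(dt) < ∞` and `m(t) = ∫₀^∞ e^{-ts} s σ(ds)`. Then `m` is completely
monotone, `∫₀^∞ min(1,t) m(t) dt < ∞`, and for every `λ > 0`,
`∫₀^∞ (1 - e^{-λt}) m(t) dt = ∫₀^∞ λ/(λ+t) σ(dt)`: the complete Bernstein function
with Stieltjes measure `σ` has Lévy density `m`. -/
theorem statement14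
    (σ : Measure ℝ)
    (hσ_int : IntegrableOn (fun t => (1 + t)⁻¹) (Set.Ioi 0) σ)
    (m : ℝ → ℝ)
    (hm : ∀ t, 0 < t → m t = ∫ s in Set.Ioi 0, Real.exp (-t * s) * s ∂σ) :
    CompletelyMonotone m ∧
    IntegrableOn (fun t => min 1 t * m t) (Set.Ioi 0) ∧
    ∀ l, 0 < l →
      ∫ t in Set.Ioi 0, (1 - Real.exp (-l * t)) * m t
        = ∫ t in Set.Ioi 0, l / (l + t) ∂σ := by
  have hcm := completelyMonotone_laplace hσ_int hm
  have hσ_fin := sigmaFinite_restrict_Ioi_of_integrableOn_inv hσ_int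
  have hinner : ∀ l : ℝ, EqOn (fun t => (1 - Real.exp (-l * t)) * m t)
      (fun t => ∫ s in Ioi 0, (1 - Real.exp (-l * t)) * (Real.exp (-t * s) * s) ∂σ) (Ioi 0) :=
    fun l t ht => by simp only [hm t ht, integral_const_mul]
  refine ⟨hcm, ?_, fun l hl => ?_⟩
  · have h1 : IntegrableOn (fun t => (1 - Real.exp (-1 * t)) * m t) (Ioi 0) :=
      IntegrableOn.congr_fun
        (integrable_one_sub_exp_mul_exp_mul_prod hσ_int one_pos).integral_prod_left
        (hinner 1).symm measurableSet_Ioi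
    refine Integrable.mono' (h1.const_mul 2) ?_ ?_
    · exact (by fun_prop : Continuous fun t : ℝ => min 1 t).aestronglyMeasurable.mul
        (hcm.1.continuousOn.aestronglyMeasurable measurableSet_Ioi)
    · filter_upwards [ae_restrict_mem measurableSet_Ioi] with t ht
      have ht' : 0 < t := ht
      have hm0 : 0 ≤ m t := by simpa using hcm.2 0 t ht
      rw [Real.norm_of_nonneg (by positivity), ← mul_assoc, neg_one_mul]
      exact mul_le_mul_of_nonneg_right (min_one_le_two_mul_one_sub_exp_neg ht) hm0
  · rw [setIntegral_congr_fun measurableSet_Ioi (hinner l),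
      integral_integral_swap (integrable_one_sub_exp_mul_exp_mul_prod hσ_int hl)]
    exact setIntegral_congr_fun measurableSet_Ioi
      fun s hs => integral_one_sub_exp_mul_exp_mul hl hs
end
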